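/- Let Λ be the Leech lattice. There exists a maximal isotropic subspace F_0 of Λ/2Λ (with respect to the quadratic form q(a+2Λ)=(a,a)/2 mod 2) whose orbit under Aut(Λ) has odd cardinality. -/

import Mathlib

open Matrix Module

/-- An even unimodular positive definite lattice of rank `m`, presented by the Gram
matrix of a `ℤ`-basis.  The underlying `ℤ`-module is `Fin m → ℤ`. -/
structure EvenUnimodularLattice (m : ℕ) where
  gram : Matrix (Fin m) (Fin m) ℤ
  symm : gram.IsSymm
  posdef : ∀ x : Fin m → ℤ, x ≠ 0 → 0 < x ⬝ᵥ gram.mulVec x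
  even : ∀ x : Fin m → ℤ, 2 ∣ x ⬝ᵥ gram.mulVec x
  unimodular : gram.det = 1

namespace EvenUnimodularLattice

variable {m : ℕ} (Λ : EvenUnimodularLattice m)

/-- The bilinear form `(x, y)` of the lattice. -/
def inner (Λ : EvenUnimodularLattice m) (x y : Fin m → ℤ) : ℤ := x ⬝ᵥ Λ.gram.mulVec y

/-- Reduction modulo `2Λ`, identifying `Λ/2Λ` with `(F₂)^m` via the chosen basis. -/
def red (_Λ : EvenUnimodularLattice m) (x : Fin m → ℤ) : Fin m → ZMod 2 := fun i => (x i : ZMod 2)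

/-- A subspace `F ⊆ Λ/2Λ` is isotropic for the quadratic form
`q(x mod 2Λ) = (x,x)/2 mod 2`, i.e. `(x,x) ≡ 0 (mod 4)` for every lift `x` of an
element of `F`. -/
def Isotropic (F : Submodule (ZMod 2) (Fin m → ZMod 2)) : Prop :=
  ∀ x : Fin m → ℤ, Λ.red x ∈ F → (4 : ℤ) ∣ Λ.inner x x

/-- A maximal isotropic subspace of `Λ/2Λ`. -/
def MaximalIsotropic (F : Submodule (ZMod 2) (Fin m → ZMod 2)) : Prop :=
  Λ.Isotropic F ∧ ∀ F', Λ.Isotropic F' → F ≤ F' → F' = F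

end EvenUnimodularLattice

def IsLeech (Λ : EvenUnimodularLattice 24) : Prop :=
  ∀ v : Fin 24 → ℤ, Λ.inner v v ≠ 2

open Matrix Module

section Poisson
open MeasureTheory UnitAddTorus

variable {d : ℕ}

/-- unit cube translated by `m` -/
def poisCube (m : Fin d → ℤ) : Set (Fin d → ℝ) :=
  {x | ∀ i, x i ∈ Set.Ioc ((m i : ℝ)) ((m i : ℝ) + 1)}

lemma poisCube_meas (m : Fin d → ℤ) : MeasurableSet (poisCube m) := by
  have : poisCube m = Set.pi Set.univ (fun i => Set.Ioc ((m i : ℝ)) ((m i : ℝ) + 1)) := by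
    ext x; simp [poisCube]
  rw [this]
  exact MeasurableSet.univ_pi (fun i => measurableSet_Ioc)

lemma poisCube_disj : Pairwise (Function.onFun Disjoint (poisCube (d := d))) := by
  intro m n hmn
  rw [Function.onFun, Set.disjoint_left]
  intro x hx hy
  apply hmn
  funext i
  have h1 := hx i
  have h2 := hy i
  have a : (m i : ℝ) < n i + 1 := lt_of_lt_of_le h1.1 h2.2
  have b : (n i : ℝ) < m i + 1 := lt_of_lt_of_le h2.1 h1.2
  norm_cast at a b
  omega

lemma poisCube_union : (⋃ m : Fin d → ℤ, poisCube m) = Set.univ := by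
  rw [Set.eq_univ_iff_forall]
  intro x
  rw [Set.mem_iUnion]
  refine ⟨fun i => ⌈x i⌉ - 1, fun i => ?_⟩
  push_cast
  refine ⟨?_, ?_⟩
  · linarith [Int.ceil_lt_add_one (x i)]
  · linarith [Int.le_ceil (x i)]

/-- integer vector as a real vector -/
def vecR (m : Fin d → ℤ) : Fin d → ℝ := fun i => (m i : ℝ)

lemma poisCube_integral {E : Type*} [NormedAddCommGroup E] [NormedSpace ℝ E]
    (g : (Fin d → ℝ) → E) (m : Fin d → ℤ) :
    ∫ x in poisCube m, g x = ∫ x in poisCube 0, g (x + vecR m) := by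
  have hmp : MeasurePreserving (fun x : Fin d → ℝ => x + vecR m) volume volume :=
    measurePreserving_add_right _ _
  have := hmp.setIntegral_preimage_emb (measurableEmbedding_addRight _) g (poisCube m)
  rw [← this]
  congr 2
  ext x
  simp only [poisCube, vecR, Set.mem_preimage, Set.mem_setOf_eq, Pi.add_apply, Set.mem_Ioc,
    Pi.zero_apply, Int.cast_zero]
  refine forall_congr' fun i => ?_
  constructor <;> rintro ⟨h1, h2⟩ <;> constructor <;> linarith

lemma pois_integral_tsum (g : (Fin d → ℝ) → ℂ) (hg : Integrable g) :
    ∫ x in poisCube 0, ∑' m : Fin d → ℤ, g (x + vecR m) = ∫ x, g x := by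
  have h1 := hasSum_integral_iUnion (f := g) (μ := volume) (fun m => poisCube_meas m)
    poisCube_disj (by rw [poisCube_union]; exact hg.integrableOn)
  have h2 := hasSum_integral_iUnion (f := fun x => ‖g x‖) (μ := volume) (fun m => poisCube_meas m)
    poisCube_disj (by rw [poisCube_union]; exact hg.norm.integrableOn)
  rw [poisCube_union, setIntegral_univ] at h1 h2
  replace h1 := h1.congr_fun (fun m => (poisCube_integral g m).symm)
  replace h2 := h2.congr_fun (fun m => (poisCube_integral (fun x => ‖g x‖) m).symm)
  have h3 := hasSum_integral_of_summable_integral_norm (μ := volume.restrict (poisCube 0))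
    (F := fun (m : Fin d → ℤ) x => g (x + vecR m))
    (fun m => (hg.comp_add_right _).integrableOn) h2.summable
  exact h3.unique h1

lemma mFourier_coe (n : Fin d → ℤ) (x : Fin d → ℝ) :
    mFourier n (fun i => (x i : UnitAddCircle)) =
      Complex.exp (2 * Real.pi * Complex.I * ∑ i, (n i : ℂ) * x i) := by
  simp only [mFourier, ContinuousMap.coe_mk, fourier_coe_apply]
  rw [← Complex.exp_sum]
  congr 1
  rw [Finset.mul_sum]
  refine Finset.sum_congr rfl fun i _ => ?_
  simp; ring

theorem poisson_multi (f : (Fin d → ℝ) → ℂ) (hf : Continuous f) (hfi : Integrable f)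
    (hb : ∀ R : ℝ, ∃ u : (Fin d → ℤ) → ℝ, Summable u ∧
      ∀ m, ∀ x : Fin d → ℝ, (∀ i, |x i| < R) → ‖f (x + vecR m)‖ ≤ u m)
    (hs : Summable fun n : Fin d → ℤ => ∫ x : Fin d → ℝ,
      Complex.exp (2 * Real.pi * Complex.I * ∑ i, ((-n i : ℤ) : ℂ) * x i) * f x) :
    ∑' m : Fin d → ℤ, f (vecR m) = ∑' n : Fin d → ℤ, ∫ x : Fin d → ℝ,
      Complex.exp (2 * Real.pi * Complex.I * ∑ i, ((-n i : ℤ) : ℂ) * x i) * f x := by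
  set G : (Fin d → ℝ) → ℂ := fun x => ∑' m : Fin d → ℤ, f (x + vecR m) with hG
  have hGc : Continuous G := by
    rw [continuous_iff_continuousAt]
    intro x
    obtain ⟨u, hu, hub⟩ := hb (‖x‖ + 1)
    have ho : IsOpen {y : Fin d → ℝ | ∀ i, |y i| < ‖x‖ + 1} := by
      simp only [Set.ofPred_forall]
      exact isOpen_iInter_of_finite fun i => isOpen_lt (by fun_prop) continuous_const
    have hc : ContinuousOn G {y : Fin d → ℝ | ∀ i, |y i| < ‖x‖ + 1} := by
      apply continuousOn_tsum (u := u)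
      · intro m; exact (hf.comp (by fun_prop)).continuousOn
      · exact hu
      · intro m y hy; exact hub m y hy
    refine hc.continuousAt (ho.mem_nhds ?_)
    intro i
    have := norm_le_pi_norm x i
    rw [Real.norm_eq_abs] at this
    linarith
  have hGp : ∀ x (k : Fin d → ℤ), G (x + vecR k) = G x := by
    intro x k
    simp only [hG]
    rw [← (Equiv.addLeft k).tsum_eq (fun m => f (x + vecR m))]
    congr 1; funext m
    congr 1
    funext i; simp [vecR]; ring
  let p : (Fin d → ℝ) → UnitAddTorus (Fin d) := Pi.map (fun _ (x : ℝ) => (x : UnitAddCircle))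
  have hp : IsOpenQuotientMap p := by
    apply IsOpenQuotientMap.piMap
    intro i
    exact QuotientAddGroup.isOpenQuotientMap_mk
  have hfac : ∀ x y, p x = p y → G x = G y := by
    intro x y hxy
    have : ∀ i, ∃ k : ℤ, x i = y i + k := by
      intro i
      have h := congrFun hxy i
      simp only [p, Pi.map_apply] at h
      rw [← sub_eq_zero, ← AddCircle.coe_sub, AddCircle.coe_eq_zero_iff] at h
      obtain ⟨k, hk⟩ := h
      refine ⟨k, ?_⟩
      simp at hk
      linarith
    choose k hk using this
    have : x = y + vecR k := by funext i; simp [vecR, hk]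
    rw [this, hGp]
  let F : C(UnitAddTorus (Fin d), ℂ) := Topology.IsQuotientMap.lift (f := ⟨p, hp.continuous⟩)
    hp.isQuotientMap ⟨G, hGc⟩ (fun x y h => hfac x y h)
  have hF : ∀ x : Fin d → ℝ, F (fun i => (x i : UnitAddCircle)) = G x := by
    intro x
    exact congrArg (fun h => h x) (Topology.IsQuotientMap.lift_comp (f := ⟨p, hp.continuous⟩)
      hp.isQuotientMap (⟨G, hGc⟩ : C(Fin d → ℝ, ℂ)) (fun x y h => hfac x y h))
  have hcoef : ∀ n, mFourierCoeff F n = ∫ x : Fin d → ℝ,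
      Complex.exp (2 * Real.pi * Complex.I * ∑ i, ((-n i : ℤ) : ℂ) * x i) * f x := by
    intro n
    rw [mFourierCoeff_eq_integral _ _ 0]
    simp_rw [hF, mFourier_coe]
    rw [← pois_integral_tsum]
    · have : {x : Fin d → ℝ | ∀ i, x i ∈ Set.Ioc ((0 : Fin d → ℝ) i) ((0 : Fin d → ℝ) i + 1)} = poisCube 0 := by
        ext x; simp [poisCube]
      rw [this]
      congr 1
      funext x
      simp only [hG, smul_eq_mul]
      rw [← tsum_mul_left]
      congr 1; funext m
      congr 1
      have : 2 * (Real.pi : ℂ) * Complex.I * ∑ i, ((-n i : ℤ) : ℂ) * ((x + vecR m) i : ℝ)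
        = 2 * (Real.pi : ℂ) * Complex.I * ∑ i, (((-n) i : ℤ) : ℂ) * (x i : ℝ)
          + ((∑ i, -n i * m i : ℤ) : ℂ) * (2 * Real.pi * Complex.I) := by
        simp [vecR, mul_add, Finset.sum_add_distrib]
        ring
      rw [this, Complex.exp_add, Complex.exp_int_mul_two_pi_mul_I, mul_one]
    · refine hfi.bdd_mul (c := 1) ?_ ?_
      · exact (Continuous.aestronglyMeasurable (by fun_prop))
      · refine Filter.Eventually.of_forall fun x => ?_
        rw [Complex.norm_exp]
        simp
  have hs' : Summable (mFourierCoeff F) := by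
    refine hs.congr ?_
    intro n; rw [hcoef]
  have := hasSum_mFourier_series_apply_of_summable hs' (fun i => ((0 : Fin d → ℝ) i : UnitAddCircle))
  rw [hF] at this
  simp_rw [mFourier_coe, hcoef] at this
  simp only [Pi.zero_apply, Complex.ofReal_zero, mul_zero, Finset.sum_const_zero, Complex.exp_zero, smul_eq_mul, mul_one] at this
  rw [this.tsum_eq]
  simp only [hG, zero_add]

end Poisson

open Matrix Module

section Gauss
open MeasureTheory

variable {d : ℕ}

lemma summable_gauss_one {c : ℝ} (hc : 0 < c) : Summable fun m : ℤ => Real.exp (-c * (m : ℝ) ^ 2) := by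
  have h0 : Summable fun m : ℕ => Real.exp (-c * (m : ℝ) ^ 2) := by
    have := Real.summable_exp_nat_mul_iff (a := -c) |>.2 (by linarith)
    refine Summable.of_nonneg_of_le (fun _ => (Real.exp_pos _).le) (fun m => ?_) this
    apply Real.exp_le_exp.2
    have : (m : ℝ) ≤ (m : ℝ) ^ 2 := by
      have : m ≤ m ^ 2 := Nat.le_self_pow (by norm_num) m
      exact_mod_cast this
    nlinarith
  apply Summable.of_nat_of_neg
  · simpa using h0
  · simpa using h0

lemma summable_gauss {c : ℝ} (hc : 0 < c) (d : ℕ) :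
    Summable fun m : Fin d → ℤ => Real.exp (-c * ∑ i, (m i : ℝ) ^ 2) := by
  induction d with
  | zero => exact Summable.of_finite
  | succ d ih =>
    have h := (summable_gauss_one hc).mul_of_nonneg ih (fun _ => (Real.exp_pos _).le)
      (fun _ => (Real.exp_pos _).le)
    rw [← (Fin.consEquiv (fun _ : Fin (d+1) => ℤ)).summable_iff]
    refine h.congr (fun p => ?_)
    rw [← Real.exp_add]
    simp [Fin.sum_univ_succ, Fin.consEquiv]
    ring

/-- sum of squares of `B x` -/
noncomputable def sqB (B : Matrix (Fin d) (Fin d) ℝ) (x : Fin d → ℝ) : ℝ := ∑ i, (B.mulVec x i) ^ 2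

lemma sqB_nonneg (B : Matrix (Fin d) (Fin d) ℝ) (x : Fin d → ℝ) : 0 ≤ sqB B x :=
  Finset.sum_nonneg fun i _ => sq_nonneg _

lemma sqB_lower (B : Matrix (Fin d) (Fin d) ℝ) (hB : B.det ≠ 0) :
    ∃ k : ℝ, 0 < k ∧ ∀ x : Fin d → ℝ, k * ∑ i, (x i) ^ 2 ≤ sqB B x := by
  set K : ℝ := (∑ i, ∑ j, (B⁻¹ i j) ^ 2) + 1 with hK
  have hK0 : 0 < K := by positivity
  refine ⟨K⁻¹, inv_pos.2 hK0, fun x => ?_⟩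
  rw [inv_mul_le_iff₀ hK0]
  have hx : x = B⁻¹.mulVec (B.mulVec x) := by
    rw [Matrix.mulVec_mulVec, Matrix.nonsing_inv_mul _ (isUnit_iff_ne_zero.2 hB), Matrix.one_mulVec]
  have h1 : ∀ i, (x i) ^ 2 ≤ (∑ j, (B⁻¹ i j) ^ 2) * sqB B x := by
    intro i
    conv_lhs => rw [hx]
    exact Finset.sum_mul_sq_le_sq_mul_sq Finset.univ (fun j => B⁻¹ i j) (fun j => B.mulVec x j)
  calc ∑ i, (x i) ^ 2 ≤ ∑ i, (∑ j, (B⁻¹ i j) ^ 2) * sqB B x := Finset.sum_le_sum fun i _ => h1 i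
    _ = (∑ i, ∑ j, (B⁻¹ i j) ^ 2) * sqB B x := by rw [Finset.sum_mul]
    _ ≤ K * sqB B x := by
      have := sqB_nonneg B x
      rw [hK]; nlinarith

lemma summable_sqB (B : Matrix (Fin d) (Fin d) ℝ) (hB : B.det ≠ 0) {c : ℝ} (hc : 0 < c) :
    Summable fun m : Fin d → ℤ => Real.exp (-c * sqB B (vecR m)) := by
  obtain ⟨k, hk, h⟩ := sqB_lower B hB
  refine Summable.of_nonneg_of_le (fun _ => (Real.exp_pos _).le) (fun m => ?_)
    (summable_gauss (mul_pos hc hk) d)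
  apply Real.exp_le_exp.2
  have := mul_le_mul_of_nonneg_left (h (vecR m)) hc.le
  simp only [vecR] at this ⊢
  linarith

lemma norm_gaussB (B : Matrix (Fin d) (Fin d) ℝ) (b : ℂ) (x : Fin d → ℝ) :
    ‖Complex.exp (-b * (sqB B x : ℂ))‖ = Real.exp (-b.re * sqB B x) := by
  rw [Complex.norm_exp]; simp

lemma continuous_sqB (B : Matrix (Fin d) (Fin d) ℝ) : Continuous (sqB B) := by
  unfold sqB
  have : Continuous fun x : Fin d → ℝ => B.mulVec x := Continuous.matrix_mulVec continuous_const continuous_id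
  fun_prop

lemma gaussB_bound (B : Matrix (Fin d) (Fin d) ℝ) (hB : B.det ≠ 0) {b : ℂ} (hb : 0 < b.re) (R : ℝ) :
    ∃ u : (Fin d → ℤ) → ℝ, Summable u ∧ ∀ m, ∀ x : Fin d → ℝ, (∀ i, |x i| < R) →
      ‖Complex.exp (-b * (sqB B (x + vecR m) : ℂ))‖ ≤ u m := by
  obtain ⟨k, hk, h⟩ := sqB_lower B hB
  set c := b.re * k with hc
  have hc0 : 0 < c := mul_pos hb hk
  refine ⟨fun m => Real.exp (c * d * R ^ 2) * Real.exp (-(c/2) * ∑ i, (m i : ℝ) ^ 2),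
    (summable_gauss (half_pos hc0) d).mul_left _, fun m x hx => ?_⟩
  rw [norm_gaussB]
  beta_reduce
  rw [← Real.exp_add]
  apply Real.exp_le_exp.2
  have h1 := mul_le_mul_of_nonneg_left (h (x + vecR m)) hb.le
  have h2 : ∑ i, ((m i : ℝ) ^ 2 / 2 - R ^ 2) ≤ ∑ i, ((x + vecR m) i) ^ 2 := by
    refine Finset.sum_le_sum fun i _ => ?_
    have hxR : (x i) ^ 2 ≤ R ^ 2 := by
      rw [← sq_abs]; exact pow_le_pow_left₀ (abs_nonneg _) (hx i).le 2
    simp only [Pi.add_apply, vecR]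
    nlinarith [sq_nonneg (2 * x i + m i)]
  rw [Finset.sum_sub_distrib, ← Finset.sum_div] at h2
  simp only [Finset.sum_const, Finset.card_univ, Fintype.card_fin, nsmul_eq_mul] at h2
  have h3 := mul_le_mul_of_nonneg_left h2 hc0.le
  have h4 : c * ∑ i, ((x + vecR m) i) ^ 2 ≤ b.re * sqB B (x + vecR m) := by
    rw [hc, mul_assoc]; exact h1
  linarith

lemma measurePreservingB (B : Matrix (Fin d) (Fin d) ℝ) (hB : |B.det| = 1) :
    MeasurePreserving (fun x : Fin d → ℝ => B.mulVec x) := by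
  have hB0 : B.det ≠ 0 := by intro h; simp [h] at hB
  have h := Real.map_matrix_volume_pi_eq_smul_volume_pi hB0
  refine ⟨(Continuous.matrix_mulVec continuous_const continuous_id).measurable, ?_⟩
  rw [abs_inv, hB] at h
  simp only [inv_one, ENNReal.ofReal_one, one_smul] at h
  exact h

lemma gaussB_fourier (B : Matrix (Fin d) (Fin d) ℝ) (hB : |B.det| = 1) {b : ℂ} (hb : 0 < b.re)
    (n : Fin d → ℤ) :
    Integrable (fun x : Fin d → ℝ => Complex.exp (2 * Real.pi * Complex.I * ∑ i, ((-n i : ℤ) : ℂ) * x i)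
      * Complex.exp (-b * (sqB B x : ℂ))) ∧
    ∫ x : Fin d → ℝ, Complex.exp (2 * Real.pi * Complex.I * ∑ i, ((-n i : ℤ) : ℂ) * x i)
      * Complex.exp (-b * (sqB B x : ℂ)) =
    (Real.pi / b) ^ ((d : ℂ) / 2) * Complex.exp (-(Real.pi ^ 2 / b) * (sqB (B⁻¹)ᵀ (vecR n) : ℂ)) := by
  have hB0 : B.det ≠ 0 := by intro h; simp [h] at hB
  have hb0 : b ≠ 0 := by intro h; simp [h] at hb
  set w : Fin d → ℝ := (B⁻¹)ᵀ.mulVec (vecR n) with hw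
  set c : Fin d → ℂ := fun j => -(2 * Real.pi * Complex.I) * (w j : ℂ) with hc
  set g : (Fin d → ℝ) → ℂ := fun v => Complex.exp (-b * ∑ i, (v i : ℂ) ^ 2 + ∑ i, c i * v i) with hg
  have key : (fun x : Fin d → ℝ => Complex.exp (2 * Real.pi * Complex.I * ∑ i, ((-n i : ℤ) : ℂ) * x i)
      * Complex.exp (-b * (sqB B x : ℂ))) = fun x => g (B.mulVec x) := by
    funext x
    rw [hg, ← Complex.exp_add]
    congr 1
    have e1 : ∑ i, (w i) * (B.mulVec x i) = ∑ i, (n i : ℝ) * x i := by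
      change w ⬝ᵥ B.mulVec x = vecR n ⬝ᵥ x
      rw [hw, Matrix.mulVec_transpose, ← Matrix.dotProduct_mulVec, Matrix.mulVec_mulVec,
        Matrix.nonsing_inv_mul _ (isUnit_iff_ne_zero.2 hB0), Matrix.one_mulVec]
    have e2 : ∑ i, c i * (B.mulVec x i : ℂ) = -(2 * Real.pi * Complex.I) * ((∑ i, (w i) * (B.mulVec x i) : ℝ) : ℂ) := by
      push_cast
      rw [Finset.mul_sum]
      exact Finset.sum_congr rfl fun i _ => by rw [hc]; ring
    rw [e2, e1]
    simp only [sqB]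
    push_cast
    simp only [neg_mul, Finset.sum_neg_distrib]
    ring
  have hgi : Integrable g := GaussianFourier.integrable_cexp_neg_mul_sum_add hb c
  have hmp := measurePreservingB B hB
  rw [key]
  constructor
  · exact (hmp.integrable_comp hgi.aestronglyMeasurable).2 hgi
  · have : ∫ x, g (B.mulVec x) = ∫ y, g y := by
      have h1 := integral_map (μ := volume) (φ := fun x : Fin d → ℝ => B.mulVec x) hmp.measurable.aemeasurable
        (f := g) (by rw [hmp.map_eq]; exact hgi.aestronglyMeasurable)
      rw [hmp.map_eq] at h1
      exact h1.symm
    rw [this, hg, GaussianFourier.integral_cexp_neg_mul_sum_add hb c]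
    simp only [Fintype.card_fin]
    congr 2
    have e3 : ∑ i, c i ^ 2 = -(4 * Real.pi ^ 2) * (sqB (B⁻¹)ᵀ (vecR n) : ℂ) := by
      simp only [sqB, hc, ← hw]
      push_cast
      rw [Finset.mul_sum]
      refine Finset.sum_congr rfl fun i _ => ?_
      ring_nf
      rw [Complex.I_sq]; ring
    rw [e3]
    field_simp

theorem gauss_poisson (B : Matrix (Fin d) (Fin d) ℝ) (hB : |B.det| = 1) {b : ℂ} (hb : 0 < b.re) :
    ∑' m : Fin d → ℤ, Complex.exp (-b * (sqB B (vecR m) : ℂ)) =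
    (Real.pi / b) ^ ((d : ℂ) / 2) *
      ∑' n : Fin d → ℤ, Complex.exp (-(Real.pi ^ 2 / b) * (sqB (B⁻¹)ᵀ (vecR n) : ℂ)) := by
  have hB0 : B.det ≠ 0 := by intro h; simp [h] at hB
  have hb0 : b ≠ 0 := by intro h; simp [h] at hb
  have hre : 0 < ((Real.pi : ℂ) ^ 2 / b).re := by
    rw [div_eq_mul_inv, ← Complex.ofReal_pow, Complex.re_ofReal_mul, Complex.inv_re]
    have : 0 < Complex.normSq b := Complex.normSq_pos.2 hb0
    positivity
  have hdual : Summable fun n : Fin d → ℤ =>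
      Complex.exp (-(Real.pi ^ 2 / b) * (sqB (B⁻¹)ᵀ (vecR n) : ℂ)) := by
    apply Summable.of_norm
    simp_rw [norm_gaussB]
    exact summable_sqB _ (by simp [Matrix.det_transpose, Matrix.det_nonsing_inv, hB0]) hre
  have h := poisson_multi (d := d) (fun x => Complex.exp (-b * (sqB B x : ℂ)))
    (by have := continuous_sqB B; fun_prop)
    (by have := (gaussB_fourier B hB hb 0).1; simpa using this)
    (fun R => gaussB_bound B hB0 hb R)
    (by
      simp_rw [fun n => (gaussB_fourier B hB hb n).2]
      exact hdual.mul_left _)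
  rw [h]
  simp_rw [fun n => (gaussB_fourier B hB hb n).2]
  rw [tsum_mul_left]
end Gauss

open Matrix Module

namespace EvenUnimodularLattice
variable {d : ℕ} (Λ : EvenUnimodularLattice d)

lemma real_posSemidef : (Λ.gram.map (Int.cast : ℤ → ℝ)).PosSemidef := by
  set A : Matrix (Fin d) (Fin d) ℝ := Λ.gram.map (Int.cast : ℤ → ℝ) with hA
  have hquad : ∀ v : Fin d → ℤ, vecR v ⬝ᵥ A.mulVec (vecR v) = ((v ⬝ᵥ Λ.gram.mulVec v : ℤ) : ℝ) := by
    intro v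
    simp [vecR, dotProduct, Matrix.mulVec, hA]
  have hnn : ∀ v : Fin d → ℤ, 0 ≤ vecR v ⬝ᵥ A.mulVec (vecR v) := by
    intro v
    rw [hquad]
    by_cases h : v = 0
    · simp [h]
    · exact_mod_cast (Λ.posdef v h).le
  have hcont : Continuous fun x : Fin d → ℝ => x ⬝ᵥ A.mulVec x :=
    Continuous.dotProduct continuous_id (Continuous.matrix_mulVec continuous_const continuous_id)
  refine Matrix.PosSemidef.of_dotProduct_mulVec_nonneg ?_ ?_
  · ext i j
    have := Λ.symm.apply i j
    simp [hA, this]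
  · intro x
    rw [star_trivial]
    -- approximate x by floor(N x)/N
    have hlim : Filter.Tendsto (fun N : ℕ => fun i => (⌊x i * N⌋ : ℝ) / N) Filter.atTop (nhds x) := by
      rw [tendsto_pi_nhds]
      intro i
      have := (tendsto_nat_floor_mul_div_atTop (R := ℝ) (a := 1) zero_le_one)
      refine tendsto_of_tendsto_of_tendsto_of_le_of_le' (g := fun N : ℕ => x i - 1 / N) (h := fun _ => x i) ?_ tendsto_const_nhds ?_ ?_
      · have := (tendsto_const_nhds (x := x i)).sub (tendsto_one_div_atTop_nhds_zero_nat (𝕜 := ℝ))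
        simpa using this
      · filter_upwards [Filter.eventually_gt_atTop 0] with N hN
        have hN' : (0 : ℝ) < N := by exact_mod_cast hN
        rw [le_div_iff₀ hN', sub_mul, one_div, inv_mul_cancel₀ hN'.ne']
        linarith [Int.lt_floor_add_one (x i * N)]
      · filter_upwards [Filter.eventually_gt_atTop 0] with N hN
        have hN' : (0 : ℝ) < N := by exact_mod_cast hN
        rw [div_le_iff₀ hN']
        exact Int.floor_le _
    refine ge_of_tendsto' ((hcont.tendsto x).comp hlim) (fun N => ?_)
    have e : (fun i => (⌊x i * N⌋ : ℝ) / N) = ((N : ℝ)⁻¹) • vecR (fun i => ⌊x i * N⌋) := by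
      funext i; simp [vecR]; ring
    simp only [Function.comp_apply]
    rw [e, Matrix.mulVec_smul, smul_dotProduct, dotProduct_smul, smul_smul, smul_eq_mul]
    exact mul_nonneg (mul_self_nonneg _) (hnn _)

open scoped MatrixOrder in
lemma exists_B : ∃ B : Matrix (Fin d) (Fin d) ℝ, |B.det| = 1 ∧ Bᵀ * B = Λ.gram.map (Int.cast : ℤ → ℝ) := by
  obtain ⟨B, hB⟩ := (CStarAlgebra.nonneg_iff_eq_star_mul_self (a := Λ.gram.map (Int.cast : ℤ → ℝ))).1 Λ.real_posSemidef.nonneg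
  have hB' : Bᵀ * B = Λ.gram.map (Int.cast : ℤ → ℝ) := by
    rw [hB, Matrix.star_eq_conjTranspose, Matrix.conjTranspose_eq_transpose_of_trivial]
  refine ⟨B, ?_, hB'⟩
  have h1 : (Bᵀ * B).det = 1 := by
    rw [hB']
    have := (Int.castRingHom ℝ).map_det Λ.gram
    rw [Λ.unimodular] at this
    simpa using this.symm
  rw [Matrix.det_mul, Matrix.det_transpose] at h1
  rw [← sq_eq_sq₀ (abs_nonneg _) zero_le_one, sq_abs]
  linarith [sq B.det]

/-- real-cast of vectors under `B` gives the norm -/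
lemma sqB_eq {B : Matrix (Fin d) (Fin d) ℝ} (hB : Bᵀ * B = Λ.gram.map (Int.cast : ℤ → ℝ)) (v : Fin d → ℤ) :
    sqB B (vecR v) = (Λ.inner v v : ℝ) := by
  have : sqB B (vecR v) = vecR v ⬝ᵥ (Λ.gram.map (Int.cast : ℤ → ℝ)).mulVec (vecR v) := by
    rw [← hB, ← Matrix.mulVec_mulVec, Matrix.dotProduct_mulVec, Matrix.vecMul_transpose]
    simp [sqB, dotProduct, sq]
  rw [this]
  simp [vecR, dotProduct, Matrix.mulVec, inner]

lemma summable_theta {c : ℝ} (hc : 0 < c) :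
    Summable fun v : Fin d → ℤ => Real.exp (-c * (Λ.inner v v : ℝ)) := by
  obtain ⟨B, hB1, hB⟩ := Λ.exists_B
  have hB0 : B.det ≠ 0 := by intro h; simp [h] at hB1
  have := summable_sqB B hB0 hc
  simpa only [Λ.sqB_eq hB] using this

lemma summable_thetaC {b : ℂ} (hb : 0 < b.re) :
    Summable fun v : Fin d → ℤ => Complex.exp (-b * (Λ.inner v v : ℂ)) := by
  apply Summable.of_norm
  refine (Λ.summable_theta hb).congr fun v => ?_
  rw [Complex.norm_exp]; simp

lemma finite_le (n : ℤ) : {v : Fin d → ℤ | Λ.inner v v ≤ n}.Finite := by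
  have h := (Λ.summable_theta one_pos).tendsto_cofinite_zero
  have := h.eventually (gt_mem_nhds (Real.exp_pos (-(n : ℝ))))
  rw [Filter.eventually_cofinite] at this
  refine this.subset fun v hv => ?_
  simp only [Set.mem_setOf_eq, not_lt] at hv ⊢
  apply Real.exp_le_exp.2
  have : (Λ.inner v v : ℝ) ≤ n := by exact_mod_cast hv
  linarith

/-- multiplication by the Gram matrix as a bijection -/
noncomputable def gramEquiv : (Fin d → ℤ) ≃ (Fin d → ℤ) where
  toFun v := Λ.gram.mulVec v
  invFun v := (Λ.gram⁻¹).mulVec v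
  left_inv v := by
    simp only [Matrix.mulVec_mulVec]
    rw [Matrix.nonsing_inv_mul _ (by rw [Λ.unimodular]; exact isUnit_one), Matrix.one_mulVec]
  right_inv v := by
    simp only [Matrix.mulVec_mulVec]
    rw [Matrix.mul_nonsing_inv _ (by rw [Λ.unimodular]; exact isUnit_one), Matrix.one_mulVec]

theorem theta_S {b : ℂ} (hb : 0 < b.re) :
    ∑' v : Fin d → ℤ, Complex.exp (-b * (Λ.inner v v : ℂ)) =
    (Real.pi / b) ^ ((d : ℂ) / 2) *
      ∑' v : Fin d → ℤ, Complex.exp (-(Real.pi ^ 2 / b) * (Λ.inner v v : ℂ)) := by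
  obtain ⟨B, hB1, hB⟩ := Λ.exists_B
  have hB0 : B.det ≠ 0 := by intro h; simp [h] at hB1
  have h := gauss_poisson B hB1 hb
  have e : ∀ v, sqB (B⁻¹)ᵀ (vecR (Λ.gramEquiv v)) = sqB B (vecR v) := by
    intro v
    have : vecR (Λ.gramEquiv v) = (Bᵀ * B).mulVec (vecR v) := by
      rw [hB]; funext i; simp [vecR, gramEquiv, Matrix.mulVec, dotProduct]
    unfold sqB
    rw [this, Matrix.mulVec_mulVec, ← Matrix.mul_assoc, ← Matrix.transpose_mul,
      Matrix.mul_nonsing_inv _ (isUnit_iff_ne_zero.2 hB0), Matrix.transpose_one, Matrix.one_mul]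
  rw [← Λ.gramEquiv.tsum_eq (fun n : Fin d → ℤ => Complex.exp (-(Real.pi ^ 2 / b) * (sqB (B⁻¹)ᵀ (vecR n) : ℂ)))] at h
  simp only [e, Λ.sqB_eq hB, Complex.ofReal_intCast] at h
  exact h
end EvenUnimodularLattice

open Matrix Module

namespace EvenUnimodularLattice
open UpperHalfPlane ModularForm ModularFormClass MatrixGroups EisensteinSeries
open scoped Real ModularForm

/-- half norm as a natural number -/
def lev {d : ℕ} (Λ : EvenUnimodularLattice d) (v : Fin d → ℤ) : ℕ := (Λ.inner v v / 2).toNat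

lemma inner_self_nonneg {d : ℕ} (Λ : EvenUnimodularLattice d) (v : Fin d → ℤ) : 0 ≤ Λ.inner v v := by
  by_cases h : v = 0
  · simp [h, inner]
  · exact (Λ.posdef v h).le

lemma inner_self_eq_lev {d : ℕ} (Λ : EvenUnimodularLattice d) (v : Fin d → ℤ) :
    Λ.inner v v = 2 * (Λ.lev v : ℤ) := by
  have h1 := Λ.inner_self_nonneg v
  have h2 : 2 ∣ Λ.inner v v := Λ.even v
  unfold lev
  omega

variable (Λ : EvenUnimodularLattice 24)

/-- number of vectors of norm `2n` -/
noncomputable def cnt (n : ℕ) : ℕ := Nat.card (Λ.lev ⁻¹' {n})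

/-- theta term -/
noncomputable def thetaT (v : Fin 24 → ℤ) (τ : ℂ) : ℂ := Complex.exp (π * Complex.I * τ * (Λ.inner v v : ℂ))

/-- theta series -/
noncomputable def theta (τ : ℂ) : ℂ := ∑' v, Λ.thetaT v τ

lemma thetaT_summable {τ : ℂ} (hτ : 0 < τ.im) : Summable fun v => Λ.thetaT v τ := by
  have := Λ.summable_thetaC (b := -(π * Complex.I * τ)) (by simp; positivity)
  simpa [thetaT] using this

lemma theta_differentiableAt {τ : ℂ} (hτ : 0 < τ.im) : DifferentiableAt ℂ Λ.theta τ := by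
  have hopen : IsOpen {z : ℂ | τ.im / 2 < z.im} := isOpen_lt continuous_const Complex.continuous_im
  have := Complex.differentiableOn_tsum_of_summable_norm (F := fun v z => Λ.thetaT v z)
    (u := fun v => Real.exp (-(π * (τ.im / 2)) * (Λ.inner v v : ℝ)))
    (Λ.summable_theta (by positivity)) (U := {z : ℂ | τ.im / 2 < z.im}) (fun v => by
      unfold thetaT; fun_prop) hopen (fun v z hz => by
      unfold thetaT
      rw [Complex.norm_exp]
      apply Real.exp_le_exp.2
      have h1 : (0 : ℝ) ≤ Λ.inner v v := by exact_mod_cast Λ.inner_self_nonneg v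
      have h2 : τ.im / 2 < z.im := hz
      have h3 : π * (τ.im / 2) ≤ π * z.im := by gcongr
      have := mul_le_mul_of_nonneg_right h3 h1
      simp
      linarith)
  exact (this.differentiableAt (hopen.mem_nhds (by simp; linarith)))

lemma theta_hasSum (τ : ℍ) :
    HasSum (fun n : ℕ => (Λ.cnt n : ℂ) • (Function.Periodic.qParam 1 (τ : ℂ)) ^ n) (Λ.theta τ) := by
  have h := (Λ.thetaT_summable τ.im_pos).hasSum.tsum_fiberwise Λ.lev
  have hfun : (fun n : ℕ => (Λ.cnt n : ℂ) • (Function.Periodic.qParam 1 (τ : ℂ)) ^ n) =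
      fun c => ∑' b : Λ.lev ⁻¹' {c}, Λ.thetaT b τ := ?_
  · rw [hfun]; exact h
  funext n
  have e : ∀ v : Λ.lev ⁻¹' {n}, Λ.thetaT v τ = (Function.Periodic.qParam 1 (τ : ℂ)) ^ n := by
    rintro ⟨v, hv⟩
    have hv' : Λ.lev v = n := hv
    rw [thetaT, Λ.inner_self_eq_lev, hv', Function.Periodic.qParam, ← Complex.exp_nat_mul]
    congr 1
    push_cast; ring
  simp_rw [e]
  rw [tsum_const, cnt]
  simp

lemma theta_T (τ : ℂ) : Λ.theta (τ + 1) = Λ.theta τ := by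
  unfold theta
  congr 1
  funext v
  unfold thetaT
  rw [Λ.inner_self_eq_lev, Complex.exp_eq_exp_iff_exists_int]
  exact ⟨Λ.lev v, by push_cast; ring⟩

lemma theta_S24 {τ : ℂ} (hτ : 0 < τ.im) : Λ.theta (-τ)⁻¹ = τ ^ 12 * Λ.theta τ := by
  have hτ0 : τ ≠ 0 := by intro h; simp [h] at hτ
  have h := Λ.theta_S (b := -(π * Complex.I * τ)) (by simp; positivity)
  have hpi : (π : ℂ) ≠ 0 := by exact_mod_cast Real.pi_ne_zero
  have e1 : (π : ℂ) / (-(π * Complex.I * τ)) = Complex.I / τ := by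
    field_simp; rw [Complex.I_sq]
  have e2 : -((π : ℂ) ^ 2 / (-(π * Complex.I * τ))) = π * Complex.I * (-τ)⁻¹ := by
    field_simp; rw [Complex.I_sq]; ring
  rw [e1, e2, neg_neg, show ((24 : ℕ) : ℂ) / 2 = ((12 : ℕ) : ℂ) by norm_num, Complex.cpow_natCast] at h
  change Λ.theta τ = _ * Λ.theta (-τ)⁻¹ at h
  rw [h, div_pow, show Complex.I ^ 12 = (Complex.I ^ 4) ^ 3 by ring, Complex.I_pow_four]
  field_simp

/-- theta as function on the upper half plane -/
noncomputable def thetaH (τ : ℍ) : ℂ := Λ.theta τ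

lemma thetaH_T : (Λ.thetaH ∣[(12 : ℤ)] ModularGroup.T) = Λ.thetaH := by
  ext z
  rw [SL_slash_apply, denom, modular_T_smul]
  have e : (((1 : ℝ) +ᵥ z : ℍ) : ℂ) = z + 1 := by simp [add_comm]
  simp only [thetaH, e, Λ.theta_T]
  have h1 : (((ModularGroup.T : SL(2, ℤ)) : GL (Fin 2) ℝ) : Matrix (Fin 2) (Fin 2) ℝ) 1 0 = 0 := by
    simp [ModularGroup.coe_T]
  have h2 : (((ModularGroup.T : SL(2, ℤ)) : GL (Fin 2) ℝ) : Matrix (Fin 2) (Fin 2) ℝ) 1 1 = 1 := by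
    simp [ModularGroup.coe_T]
  rw [h1, h2]
  simp

lemma thetaH_S : (Λ.thetaH ∣[(12 : ℤ)] ModularGroup.S) = Λ.thetaH := by
  ext z
  rw [SL_slash_apply, UpperHalfPlane.modular_S_smul]
  have := Λ.theta_S24 z.im_pos
  have hz := z.ne_zero
  have h1 : (((ModularGroup.S : SL(2, ℤ)) : GL (Fin 2) ℝ) : Matrix (Fin 2) (Fin 2) ℝ) 1 0 = 1 := by
    simp [ModularGroup.coe_S]
  have h2 : (((ModularGroup.S : SL(2, ℤ)) : GL (Fin 2) ℝ) : Matrix (Fin 2) (Fin 2) ℝ) 1 1 = 0 := by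
    simp [ModularGroup.coe_S]
  rw [denom, h1, h2]
  simp only [thetaH]
  change Λ.theta (-(z : ℂ))⁻¹ * _ = _
  rw [this]
  simp
  field_simp

/-- theta as modular form -/
noncomputable def thetaM : ModularForm 𝒮ℒ 12 where
  toFun := Λ.thetaH
  slash_action_eq' A hA := by
    obtain ⟨A, rfl⟩ := hA
    exact SlashInvariantForm.slash_action_generators_SL2Z Λ.thetaH_S Λ.thetaH_T A
  holo' := by
    rw [UpperHalfPlane.mdifferentiable_iff]
    refine .congr (fun z hz ↦ (Λ.theta_differentiableAt hz).differentiableWithinAt) fun z hz ↦ ?_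
    simp [thetaH, ofComplex_apply_of_im_pos hz]
  bdd_at_cusps' hc := by
    rw [Subgroup.IsArithmetic.isCusp_iff_isCusp_SL2Z] at hc
    rw [OnePoint.isBoundedAt_iff_forall_SL2Z hc]
    intro γ _
    rw [SlashInvariantForm.slash_action_generators_SL2Z Λ.thetaH_S Λ.thetaH_T]
    exact isBoundedAtImInfty_of_hasSum_qExpansion one_pos Λ.theta_hasSum

lemma thetaM_coeff (n : ℕ) : (qExpansion 1 Λ.thetaM).coeff n = Λ.cnt n :=
  (ModularFormClass.qExpansion_coeff_unique one_pos one_mem_strictPeriods_SL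
    (f := Λ.thetaM) Λ.theta_hasSum n).symm

end EvenUnimodularLattice

open Matrix Module

namespace EvenUnimodularLattice
open UpperHalfPlane ModularForm ModularFormClass MatrixGroups EisensteinSeries
open scoped Real ModularForm ArithmeticFunction.sigma

variable (Λ : EvenUnimodularLattice 24)

lemma cnt_zero : Λ.cnt 0 = 1 := by
  have : Λ.lev ⁻¹' {0} = {0} := by
    ext v
    simp only [Set.mem_preimage, Set.mem_singleton_iff]
    have h := Λ.inner_self_eq_lev v
    constructor
    · intro h0
      by_contra hv
      have : 0 < Λ.inner v v := Λ.posdef v hv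
      rw [h, h0] at this
      simp at this
    · rintro rfl
      simp [lev, inner]
  rw [cnt, this]; simp

lemma cnt_one (hΛ : IsLeech Λ) : Λ.cnt 1 = 0 := by
  have : Λ.lev ⁻¹' {1} = ∅ := by
    ext v
    simp only [Set.mem_preimage, Set.mem_singleton_iff, Set.mem_empty_iff_false, iff_false]
    intro h
    apply hΛ v
    rw [Λ.inner_self_eq_lev, h]; rfl
  rw [cnt, this]; simp

/-- The Eisenstein combination. -/
noncomputable def eisC : ModularForm 𝒮ℒ 12 :=
  (7/12 : ℂ) • ModularForm.mcast (by decide) (E₄.pow 3) + (5/12 : ℂ) • ModularForm.mcast (by decide) (E₆.pow 2)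

lemma eisC_q : qExpansion 1 eisC = (7/12 : ℂ) • (qExpansion 1 E₄ * qExpansion 1 E₄ * qExpansion 1 E₄) +
      (5/12 : ℂ) • (qExpansion 1 E₆ * qExpansion 1 E₆) := by
  rw [eisC, FunLike.coe_add, ModularForm.qExpansion_add one_pos one_mem_strictPeriods_SL,
    FunLike.coe_smul, FunLike.coe_smul,
    ModularForm.qExpansion_smul one_pos one_mem_strictPeriods_SL,
    ModularForm.qExpansion_smul one_pos one_mem_strictPeriods_SL, coe_mcast, coe_mcast,
    ModularForm.qExpansion_pow one_pos one_mem_strictPeriods_SL,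
    ModularForm.qExpansion_pow one_pos one_mem_strictPeriods_SL, sq, pow_succ, sq]

lemma E4c (n : ℕ) (hn : n ≠ 0) : (qExpansion 1 E₄).coeff n = 240 * (σ 3 n : ℂ) := by
  rw [E_qExpansion_coeff _ ⟨2, rfl⟩, if_neg hn]
  norm_num [bernoulli]

lemma bern_six : bernoulli 6 = 1/42 := by
  rw [bernoulli_eq_bernoulli'_of_ne_one (by norm_num), bernoulli'_def]
  have h5 : bernoulli' 5 = 0 := by
    rw [bernoulli'_def]; norm_num [Finset.sum_range_succ, Nat.choose, bernoulli'_four]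
  norm_num [Finset.sum_range_succ, Nat.choose, h5, bernoulli'_four]

lemma E6c (n : ℕ) (hn : n ≠ 0) : (qExpansion 1 E₆).coeff n = -504 * (σ 5 n : ℂ) := by
  rw [E_qExpansion_coeff _ ⟨3, rfl⟩, if_neg hn]
  norm_num [bern_six]

/-- theta minus Eisenstein -/
noncomputable def diffM : ModularForm 𝒮ℒ 12 := Λ.thetaM - eisC

lemma diffM_q : qExpansion 1 Λ.diffM = qExpansion 1 Λ.thetaM - qExpansion 1 eisC := by
  rw [diffM, FunLike.coe_sub, ModularForm.qExpansion_sub one_pos one_mem_strictPeriods_SL]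

lemma eisC_coeff_zero : (qExpansion 1 eisC).coeff 0 = 1 := by
  rw [eisC_q]
  norm_num [PowerSeries.coeff_mul, -PowerSeries.coeff_zero_eq_constantCoeff,
    E_qExpansion_coeff_zero _ ⟨2, rfl⟩, E_qExpansion_coeff_zero _ ⟨3, rfl⟩]

lemma eisC_coeff_one : (qExpansion 1 eisC).coeff 1 = 0 := by
  rw [eisC_q]
  norm_num [PowerSeries.coeff_mul, Finset.Nat.antidiagonal_succ, E4c, E6c, ArithmeticFunction.sigma_apply,
    -PowerSeries.coeff_zero_eq_constantCoeff,
    E_qExpansion_coeff_zero _ ⟨2, rfl⟩, E_qExpansion_coeff_zero _ ⟨3, rfl⟩]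

lemma diffM_eq_zero (hΛ : IsLeech Λ) : Λ.diffM = 0 := by
  have h0 : (qExpansion 1 Λ.diffM).coeff 0 = 0 := by
    rw [diffM_q, map_sub, eisC_coeff_zero, Λ.thetaM_coeff, Λ.cnt_zero]; simp
  have h1 : (qExpansion 1 Λ.diffM).coeff 1 = 0 := by
    rw [diffM_q, map_sub, eisC_coeff_one, Λ.thetaM_coeff, Λ.cnt_one hΛ]; simp
  have hcusp : IsCuspForm Λ.diffM := (isCuspForm_iff_coeffZero_eq_zero _).2 h0
  obtain ⟨g, hg⟩ := hcusp
  obtain ⟨c, hc⟩ := CuspForm.exists_smul_discriminant_of_weight_eq_twelve g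
  have hgE : (g : ℍ → ℂ) = Λ.diffM := congrArg DFunLike.coe hg
  have hcΔ : (c • CuspForm.discriminant : ℍ → ℂ) = g := congrArg DFunLike.coe hc
  have hc0 : c = 0 := by
    have hgΔ := ModularForm.qExpansion_smul one_pos one_mem_strictPeriods_SL c
      CuspForm.discriminant
    rw [hcΔ, hgE] at hgΔ
    have := congr_arg (·.coeff 1) hgΔ
    simp only [h1, map_smul, CuspForm.coe_discriminant, discriminant_qExpansion_coeff_one] at this
    simpa using this.symm
  ext z
  rw [← hgE, ← hcΔ, hc0]
  simp

lemma cnt_eq (hΛ : IsLeech Λ) (n : ℕ) : (Λ.cnt n : ℂ) = (qExpansion 1 eisC).coeff n := by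
  rw [← Λ.thetaM_coeff, show Λ.thetaM = eisC from sub_eq_zero.1 (Λ.diffM_eq_zero hΛ)]

lemma cnt_two (hΛ : IsLeech Λ) : Λ.cnt 2 = 196560 := by
  have : (Λ.cnt 2 : ℂ) = 196560 := by
    rw [Λ.cnt_eq hΛ, eisC_q]
    norm_num [PowerSeries.coeff_mul, Finset.Nat.antidiagonal_succ, E4c, E6c,
      ArithmeticFunction.sigma_apply, show Nat.divisors 4 = {1, 2, 4} by decide,
      -PowerSeries.coeff_zero_eq_constantCoeff,
      E_qExpansion_coeff_zero _ ⟨2, rfl⟩, E_qExpansion_coeff_zero _ ⟨3, rfl⟩]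
  exact_mod_cast this

lemma cnt_three (hΛ : IsLeech Λ) : Λ.cnt 3 = 16773120 := by
  have : (Λ.cnt 3 : ℂ) = 16773120 := by
    rw [Λ.cnt_eq hΛ, eisC_q]
    norm_num [PowerSeries.coeff_mul, Finset.Nat.antidiagonal_succ, E4c, E6c,
      ArithmeticFunction.sigma_apply, show Nat.divisors 4 = {1, 2, 4} by decide,
      -PowerSeries.coeff_zero_eq_constantCoeff,
      E_qExpansion_coeff_zero _ ⟨2, rfl⟩, E_qExpansion_coeff_zero _ ⟨3, rfl⟩]
  exact_mod_cast this

lemma cnt_four (hΛ : IsLeech Λ) : Λ.cnt 4 = 398034000 := by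
  have : (Λ.cnt 4 : ℂ) = 398034000 := by
    rw [Λ.cnt_eq hΛ, eisC_q]
    norm_num [PowerSeries.coeff_mul, Finset.Nat.antidiagonal_succ, E4c, E6c,
      ArithmeticFunction.sigma_apply, show Nat.divisors 4 = {1, 2, 4} by decide,
      -PowerSeries.coeff_zero_eq_constantCoeff,
      E_qExpansion_coeff_zero _ ⟨2, rfl⟩, E_qExpansion_coeff_zero _ ⟨3, rfl⟩]
  exact_mod_cast this

end EvenUnimodularLattice

open Matrix Module

namespace EvenUnimodularLattice

section gen
variable {d : ℕ} (Λ : EvenUnimodularLattice d)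

lemma inner_add_left (x y z : Fin d → ℤ) : Λ.inner (x + y) z = Λ.inner x z + Λ.inner y z := by
  simp [inner, add_dotProduct]
lemma inner_add_right (x y z : Fin d → ℤ) : Λ.inner x (y + z) = Λ.inner x y + Λ.inner x z := by
  simp [inner, Matrix.mulVec_add, dotProduct_add]
lemma inner_sub_left (x y z : Fin d → ℤ) : Λ.inner (x - y) z = Λ.inner x z - Λ.inner y z := by
  simp [inner, sub_dotProduct]
lemma inner_sub_right (x y z : Fin d → ℤ) : Λ.inner x (y - z) = Λ.inner x y - Λ.inner x z := by
  simp [inner, Matrix.mulVec_sub, dotProduct_sub]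
lemma inner_neg_right (x y : Fin d → ℤ) : Λ.inner x (-y) = - Λ.inner x y := by
  simp [inner, Matrix.mulVec_neg, dotProduct_neg]
lemma inner_neg_left (x y : Fin d → ℤ) : Λ.inner (-x) y = - Λ.inner x y := by
  simp [inner, neg_dotProduct]
lemma inner_smul_left (k : ℤ) (x y : Fin d → ℤ) : Λ.inner (k • x) y = k * Λ.inner x y := by
  rw [inner, smul_dotProduct, smul_eq_mul]; rfl
lemma inner_smul_right (k : ℤ) (x y : Fin d → ℤ) : Λ.inner x (k • y) = k * Λ.inner x y := by
  rw [inner, Matrix.mulVec_smul, dotProduct_smul, smul_eq_mul]; rfl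
lemma inner_zero_left (y : Fin d → ℤ) : Λ.inner 0 y = 0 := by simp [inner]
lemma inner_symm (x y : Fin d → ℤ) : Λ.inner x y = Λ.inner y x := by
  unfold inner
  rw [dotProduct_comm, Matrix.dotProduct_mulVec, ← Matrix.mulVec_transpose, Λ.symm.eq, dotProduct_comm,
    dotProduct_comm]
lemma inner_sum_left {ι : Type*} (s : Finset ι) (f : ι → Fin d → ℤ) (y : Fin d → ℤ) :
    Λ.inner (∑ i ∈ s, f i) y = ∑ i ∈ s, Λ.inner (f i) y := by
  simp [inner, sum_dotProduct]

lemma red_add (x y : Fin d → ℤ) : Λ.red (x + y) = Λ.red x + Λ.red y := by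
  funext i; simp [red]
lemma red_neg (x : Fin d → ℤ) : Λ.red (-x) = - Λ.red x := by
  funext i; simp [red]
lemma red_zero : Λ.red 0 = 0 := by
  funext i; simp [red]
lemma red_smul (k : ℤ) (x : Fin d → ℤ) : Λ.red (k • x) = (k : ZMod 2) • Λ.red x := by
  funext i; simp [red]
lemma red_two (x : Fin d → ℤ) : Λ.red ((2 : ℤ) • x) = 0 := by
  rw [red_smul]
  have : ((2 : ℤ) : ZMod 2) = 0 := by decide
  rw [this, zero_smul]
lemma red_sum {ι : Type*} (s : Finset ι) (f : ι → Fin d → ℤ) :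
    Λ.red (∑ i ∈ s, f i) = ∑ i ∈ s, Λ.red (f i) := by
  funext j; simp [red, Finset.sum_apply]
lemma red_surj (a : Fin d → ZMod 2) : ∃ x, Λ.red x = a := by
  refine ⟨fun i => (a i).val, ?_⟩
  funext i; simp [red]
lemma red_eq_zero {x : Fin d → ℤ} (h : Λ.red x = 0) : ∃ w, x = (2 : ℤ) • w := by
  have : ∀ i, (2 : ℤ) ∣ x i := fun i => by
    have := congrFun h i
    simp only [red, Pi.zero_apply] at this
    exact_mod_cast (ZMod.intCast_zmod_eq_zero_iff_dvd (x i) 2).1 this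
  choose w hw using this
  exact ⟨w, by funext i; simp [hw i]⟩
lemma red_eq {x y : Fin d → ℤ} (h : Λ.red x = Λ.red y) : ∃ w, x = y + (2 : ℤ) • w := by
  obtain ⟨w, hw⟩ := Λ.red_eq_zero (x := x - y) (by rw [sub_eq_add_neg, red_add, red_neg, h, add_neg_cancel])
  exact ⟨w, by rw [← hw]; abel⟩

lemma two_smul_inj {x y : Fin d → ℤ} (h : (2 : ℤ) • x = (2 : ℤ) • y) : x = y := by
  funext i
  have := congrFun h i
  simp at this
  exact this

/-- pairwise orthogonal nonzero vectors: at most `d` -/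
lemma card_orth_le (S : Finset (Fin d → ℤ)) (h0 : ∀ x ∈ S, x ≠ 0)
    (ho : ∀ x ∈ S, ∀ y ∈ S, x ≠ y → Λ.inner x y = 0) : S.card ≤ d := by
  have hli : LinearIndependent ℤ (fun x : S => (x : Fin d → ℤ)) := by
    rw [Fintype.linearIndependent_iff]
    intro g hg y
    have h1 : Λ.inner (∑ x, g x • (x : Fin d → ℤ)) y = 0 := by rw [hg, inner_zero_left]
    rw [inner_sum_left, Finset.sum_eq_single y] at h1
    · rw [inner_smul_left] at h1
      rcases mul_eq_zero.1 h1 with h | h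
      · exact h
      · exact absurd h (Λ.posdef y (h0 y y.2)).ne'
    · intro b _ hb
      rw [inner_smul_left, ho b b.2 y y.2 (fun h => hb (Subtype.ext h)), mul_zero]
    · simp
  have := hli.fintype_card_le_finrank
  simpa using this
end gen

variable (Λ : EvenUnimodularLattice 24)

lemma four_le (hΛ : IsLeech Λ) {v : Fin 24 → ℤ} (hv : v ≠ 0) : 4 ≤ Λ.inner v v := by
  have h1 : 0 < Λ.inner v v := Λ.posdef v hv
  have h2 : 2 ∣ Λ.inner v v := Λ.even v
  have h3 := hΛ v
  omega

lemma congr_short (hΛ : IsLeech Λ) {u v : Fin 24 → ℤ} (h : Λ.red u = Λ.red v) (h1 : u ≠ v) (h2 : u ≠ -v)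
    (hu : Λ.inner u u ≤ 8) (hv : Λ.inner v v ≤ 8) :
    Λ.inner u u = 8 ∧ Λ.inner v v = 8 ∧ Λ.inner u v = 0 := by
  obtain ⟨w, rfl⟩ := Λ.red_eq h
  have hw : w ≠ 0 := by rintro rfl; simp at h1
  have hw2 : v + w ≠ 0 := by
    intro h
    apply h2
    have : w = -v := by rw [eq_neg_iff_add_eq_zero, add_comm]; exact h
    rw [this]; simp [two_smul]
  have a := Λ.four_le hΛ hw
  have b := Λ.four_le hΛ hw2
  have e := Λ.inner_symm v w
  simp only [inner_add_left, inner_add_right, inner_smul_left, inner_smul_right] at *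
  refine ⟨?_, ?_, ?_⟩ <;> linarith

end EvenUnimodularLattice

open Matrix Module

namespace EvenUnimodularLattice
variable (Λ : EvenUnimodularLattice 24)

lemma lev_finite (n : ℕ) : (Λ.lev ⁻¹' {n}).Finite := by
  refine (Λ.finite_le (2 * n)).subset fun v hv => ?_
  have hv' : Λ.lev v = n := hv
  change Λ.inner v v ≤ 2 * n
  rw [Λ.inner_self_eq_lev, hv']

/-- vectors of norm `2n` as a finset -/
noncomputable def shell (n : ℕ) : Finset (Fin 24 → ℤ) := (Λ.lev_finite n).toFinset

lemma mem_shell {n : ℕ} {v : Fin 24 → ℤ} : v ∈ Λ.shell n ↔ Λ.inner v v = 2 * n := by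
  have h := Λ.inner_self_eq_lev v
  simp only [shell, Set.Finite.mem_toFinset, Set.mem_preimage, Set.mem_singleton_iff]
  omega

lemma card_shell (n : ℕ) : (Λ.shell n).card = Λ.cnt n := by
  rw [cnt, shell, Nat.card_coe_set_eq, Set.ncard_eq_toFinset_card _ (Λ.lev_finite n)]

/-- classes represented in shell `n` -/
noncomputable def img (n : ℕ) : Finset (Fin 24 → ZMod 2) := (Λ.shell n).image Λ.red

lemma card_fiber_pm (S : Finset (Fin 24 → ℤ)) (h : ∀ u ∈ S, ∀ v ∈ S, u = v ∨ u = -v) : S.card ≤ 2 := by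
  rcases S.eq_empty_or_nonempty with rfl | ⟨v, hv⟩
  · simp
  · have : S ⊆ {v, -v} := by
      intro u hu
      simpa using h u hu v hv
    exact (Finset.card_le_card this).trans Finset.card_le_two

lemma card_img_small (hΛ : IsLeech Λ) (n : ℕ) (hn : n < 4) : Λ.cnt n ≤ 2 * (Λ.img n).card := by
  rw [← card_shell]
  refine Finset.card_le_mul_card_image _ _ fun b _ => card_fiber_pm _ ?_
  intro u hu v hv
  simp only [Finset.mem_filter, mem_shell] at hu hv
  by_contra hc
  push Not at hc
  have := (Λ.congr_short hΛ (hu.2.trans hv.2.symm) hc.1 hc.2 (by rw [hu.1]; omega) (by rw [hv.1]; omega)).1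
  rw [hu.1] at this
  omega

/-- The norm-8 vectors in a class. -/
noncomputable def frame (c : Fin 24 → ZMod 2) : Finset (Fin 24 → ℤ) := (Λ.shell 4).filter (fun v => Λ.red v = c)

lemma mem_frame {c : Fin 24 → ZMod 2} {v : Fin 24 → ℤ} : v ∈ Λ.frame c ↔ Λ.inner v v = 8 ∧ Λ.red v = c := by
  simp [frame, mem_shell]

lemma frame_inner (hΛ : IsLeech Λ) {c : Fin 24 → ZMod 2} {u v : Fin 24 → ℤ} (hu : u ∈ Λ.frame c)
    (hv : v ∈ Λ.frame c) : Λ.inner u v = 0 ∨ (u = v) ∨ (u = -v) := by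
  rw [mem_frame] at hu hv
  by_contra hc
  push Not at hc
  exact hc.1 (Λ.congr_short hΛ (hu.2.trans hv.2.symm) hc.2.1 hc.2.2 hu.1.le hv.1.le).2.2

lemma exists_half_frame (hΛ : IsLeech Λ) (c : Fin 24 → ZMod 2) :
    ∃ T ⊆ Λ.frame c, (Λ.frame c).card ≤ 2 * T.card ∧
      ∀ u ∈ T, ∀ v ∈ T, u ≠ v → Λ.inner u v = 0 := by
  classical
  set f : (Fin 24 → ℤ) → Finset (Fin 24 → ℤ) := fun v => {v, -v} with hf
  obtain ⟨T, hT, himg, hinj⟩ : ∃ T ⊆ Λ.frame c, T.image f = (Λ.frame c).image f ∧ Set.InjOn f T := by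
    set g := Function.invFunOn f (Λ.frame c : Set (Fin 24 → ℤ)) with hg
    have hg1 : ∀ v ∈ Λ.frame c, g (f v) ∈ Λ.frame c ∧ f (g (f v)) = f v := by
      intro v hv
      have hex : ∃ a ∈ (Λ.frame c : Set (Fin 24 → ℤ)), f a = f v := ⟨v, hv, rfl⟩
      exact ⟨Function.invFunOn_mem hex, Function.invFunOn_eq hex⟩
    refine ⟨(Λ.frame c).image (fun v => g (f v)), ?_, ?_, ?_⟩
    · intro x hx
      obtain ⟨v, hv, rfl⟩ := Finset.mem_image.1 hx
      exact (hg1 v hv).1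
    · rw [Finset.image_image]
      exact Finset.image_congr fun v hv => (hg1 v hv).2
    · intro x hx y hy hxy
      obtain ⟨v, hv, rfl⟩ := Finset.mem_image.1 hx
      obtain ⟨w, hw, rfl⟩ := Finset.mem_image.1 hy
      rw [(hg1 v hv).2, (hg1 w hw).2] at hxy
      rw [hxy]
  refine ⟨T, hT, ?_, ?_⟩
  · rw [← Finset.card_image_of_injOn hinj, himg]
    refine Finset.card_le_mul_card_image _ _ fun b _ => card_fiber_pm _ ?_
    intro u hu v hv
    simp only [Finset.mem_filter] at hu hv
    have h : u ∈ f v := by rw [hv.2, ← hu.2, hf]; simp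
    simpa [hf] using h
  · intro u hu v hv huv
    rcases Λ.frame_inner hΛ (hT hu) (hT hv) with h | h | h
    · exact h
    · exact absurd h huv
    · refine absurd (hinj hu hv ?_) huv
      rw [h, hf]; simp [Finset.pair_comm]

lemma half_frame_card {c : Fin 24 → ZMod 2} {T : Finset (Fin 24 → ℤ)} (hT : T ⊆ Λ.frame c)
    (ho : ∀ u ∈ T, ∀ v ∈ T, u ≠ v → Λ.inner u v = 0) : T.card ≤ 24 := by
  refine Λ.card_orth_le T (fun x hx h => ?_) ho
  have := (Λ.mem_frame.1 (hT hx)).1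
  rw [h, inner_zero_left] at this
  omega

lemma frame_card_le (hΛ : IsLeech Λ) (c : Fin 24 → ZMod 2) : (Λ.frame c).card ≤ 48 := by
  obtain ⟨T, hT, h1, h2⟩ := Λ.exists_half_frame hΛ c
  have := Λ.half_frame_card hT h2
  omega

lemma img_disjoint (hΛ : IsLeech Λ) {m n : ℕ} (hm : m ≤ 4) (hn : n ≤ 4) (hmn : m ≠ n) :
    Disjoint (Λ.img m) (Λ.img n) := by
  rw [Finset.disjoint_left]
  intro a ha hb
  simp only [img, Finset.mem_image, mem_shell] at ha hb
  obtain ⟨u, hu, rfl⟩ := ha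
  obtain ⟨v, hv, huv⟩ := hb
  have h1 : u ≠ v := by
    rintro rfl; omega
  have h2 : u ≠ -v := by
    rintro rfl
    rw [inner_neg_left, inner_neg_right] at hu; omega
  have := Λ.congr_short hΛ huv.symm h1 h2 (by omega) (by omega)
  omega

lemma card_frames (hΛ : IsLeech Λ) :
    (Λ.img 4).card = 8292375 ∧ ∀ c ∈ Λ.img 4, (Λ.frame c).card = 48 := by
  classical
  have d02 := Λ.img_disjoint hΛ (m := 0) (n := 2) (by norm_num) (by norm_num) (by norm_num)
  have d03 := Λ.img_disjoint hΛ (m := 0) (n := 3) (by norm_num) (by norm_num) (by norm_num)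
  have d04 := Λ.img_disjoint hΛ (m := 0) (n := 4) (by norm_num) (by norm_num) (by norm_num)
  have d23 := Λ.img_disjoint hΛ (m := 2) (n := 3) (by norm_num) (by norm_num) (by norm_num)
  have d24 := Λ.img_disjoint hΛ (m := 2) (n := 4) (by norm_num) (by norm_num) (by norm_num)
  have d34 := Λ.img_disjoint hΛ (m := 3) (n := 4) (by norm_num) (by norm_num) (by norm_num)
  have htot : (Λ.img 0 ∪ Λ.img 2 ∪ Λ.img 3 ∪ Λ.img 4).card ≤ 2 ^ 24 := by
    refine (Finset.card_le_univ _).trans ?_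
    simp [ZMod.card]
  rw [Finset.card_union_of_disjoint (by simp [d04, d24, d34]),
    Finset.card_union_of_disjoint (by simp [d03, d23]),
    Finset.card_union_of_disjoint d02] at htot
  have h0 := Λ.card_img_small hΛ 0 (by norm_num)
  have h2 := Λ.card_img_small hΛ 2 (by norm_num)
  have h3 := Λ.card_img_small hΛ 3 (by norm_num)
  rw [Λ.cnt_zero] at h0
  rw [Λ.cnt_two hΛ] at h2
  rw [Λ.cnt_three hΛ] at h3
  have h4 : (Λ.shell 4).card = ∑ c ∈ Λ.img 4, (Λ.frame c).card := Finset.card_eq_sum_card_image Λ.red (Λ.shell 4)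
  rw [Λ.card_shell, Λ.cnt_four hΛ] at h4
  have h5 : ∑ c ∈ Λ.img 4, (Λ.frame c).card ≤ ∑ c ∈ Λ.img 4, 48 :=
    Finset.sum_le_sum fun c _ => Λ.frame_card_le hΛ c
  have h6 : ∑ c ∈ Λ.img 4, 48 = (Λ.img 4).card * 48 := by simp
  norm_num at htot
  have hX : (Λ.img 4).card = 8292375 := by omega
  refine ⟨hX, ?_⟩
  have h7 : ∑ c ∈ Λ.img 4, (Λ.frame c).card = ∑ c ∈ Λ.img 4, 48 := by omega
  exact (Finset.sum_eq_sum_iff_of_le fun c _ => Λ.frame_card_le hΛ c).1 h7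

end EvenUnimodularLattice

open Matrix Module

namespace EvenUnimodularLattice
variable (Λ : EvenUnimodularLattice 24)

/-- half-sums of norm-8 vectors in the class `c` -/
def gens (c : Fin 24 → ZMod 2) : Set (Fin 24 → ℤ) :=
  {z | ∃ f ∈ Λ.frame c, ∃ g ∈ Λ.frame c, (2 : ℤ) • z = f + g}

/-- the subspace attached to the class `c` -/
def sub (c : Fin 24 → ZMod 2) : Submodule (ZMod 2) (Fin 24 → ZMod 2) :=
  Submodule.span (ZMod 2) (Λ.red '' Λ.gens c)

lemma lift_induction (s : Set (Fin 24 → ℤ)) (P : (Fin 24 → ℤ) → Prop)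
    (h2 : ∀ w, P ((2 : ℤ) • w)) (hadd : ∀ x y, P x → P y → P (x + y)) (hgen : ∀ x ∈ s, P x)
    (x : Fin 24 → ℤ) (hx : Λ.red x ∈ Submodule.span (ZMod 2) (Λ.red '' s)) : P x := by
  have key : ∀ a ∈ Submodule.span (ZMod 2) (Λ.red '' s), ∃ y, Λ.red y = a ∧ P y := by
    intro a ha
    induction ha using Submodule.span_induction with
    | mem a ha =>
      obtain ⟨z, hz, rfl⟩ := ha
      exact ⟨z, rfl, hgen z hz⟩
    | zero => exact ⟨(2 : ℤ) • 0, Λ.red_two 0, h2 0⟩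
    | add a b _ _ iha ihb =>
      obtain ⟨u, rfl, hu⟩ := iha
      obtain ⟨v, rfl, hv⟩ := ihb
      exact ⟨u + v, Λ.red_add u v, hadd u v hu hv⟩
    | smul r a _ iha =>
      have hr : ∀ r : ZMod 2, r = 0 ∨ r = 1 := by decide
      rcases hr r with rfl | rfl
      · exact ⟨(2 : ℤ) • 0, by rw [Λ.red_two 0, zero_smul], h2 0⟩
      · rw [one_smul]; exact iha
  obtain ⟨y, hy, hPy⟩ := key _ hx
  obtain ⟨w, rfl⟩ := Λ.red_eq hy.symm
  exact hadd _ _ hPy (h2 w)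

lemma frame_inner8 (hΛ : IsLeech Λ) {c : Fin 24 → ZMod 2} {u v : Fin 24 → ℤ} (hu : u ∈ Λ.frame c)
    (hv : v ∈ Λ.frame c) : (8 : ℤ) ∣ Λ.inner u v := by
  have h8 := (Λ.mem_frame.1 hv).1
  rcases Λ.frame_inner hΛ hu hv with h | h | h
  · rw [h]; exact dvd_zero _
  · rw [h, h8]
  · rw [h, inner_neg_left, h8]; exact ⟨-1, rfl⟩

lemma gens_inner (hΛ : IsLeech Λ) {c : Fin 24 → ZMod 2} {z w : Fin 24 → ℤ} (hz : z ∈ Λ.gens c)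
    (hw : w ∈ Λ.gens c) : (2 : ℤ) ∣ Λ.inner z w := by
  obtain ⟨f, hf, g, hg, h1⟩ := hz
  obtain ⟨f', hf', g', hg', h2⟩ := hw
  have h : Λ.inner ((2 : ℤ) • z) ((2 : ℤ) • w) = Λ.inner (f + g) (f' + g') := by rw [h1, h2]
  simp only [inner_add_left, inner_add_right, inner_smul_left, inner_smul_right] at h
  have a := Λ.frame_inner8 hΛ hf hf'
  have b := Λ.frame_inner8 hΛ hf hg'
  have e := Λ.frame_inner8 hΛ hg hf'
  have k := Λ.frame_inner8 hΛ hg hg'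
  omega

lemma gens_norm (hΛ : IsLeech Λ) {c : Fin 24 → ZMod 2} {z : Fin 24 → ℤ} (hz : z ∈ Λ.gens c) :
    (4 : ℤ) ∣ Λ.inner z z := by
  obtain ⟨f, hf, g, hg, h1⟩ := hz
  have h : Λ.inner ((2 : ℤ) • z) ((2 : ℤ) • z) = Λ.inner (f + g) (f + g) := by rw [h1]
  have s := Λ.inner_symm f g
  simp only [inner_add_left, inner_add_right, inner_smul_left, inner_smul_right] at h
  have a := (Λ.mem_frame.1 hf).1
  have b := (Λ.mem_frame.1 hg).1
  have e := Λ.frame_inner8 hΛ hf hg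
  omega

lemma sub_isotropic (hΛ : IsLeech Λ) (c : Fin 24 → ZMod 2) : Λ.Isotropic (Λ.sub c) := by
  have s1 : ∀ z ∈ Λ.gens c, ∀ x, Λ.red x ∈ Λ.sub c → (2 : ℤ) ∣ Λ.inner z x := by
    intro z hz x hx
    refine Λ.lift_induction (Λ.gens c) (fun x => (2 : ℤ) ∣ Λ.inner z x) ?_ ?_ ?_ x hx
    · intro w; rw [inner_smul_right]; exact dvd_mul_right _ _
    · intro x y h1 h2; rw [inner_add_right]; exact dvd_add h1 h2
    · intro w hw; exact Λ.gens_inner hΛ hz hw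
  have s2 : ∀ y, Λ.red y ∈ Λ.sub c → ∀ x, Λ.red x ∈ Λ.sub c → (2 : ℤ) ∣ Λ.inner y x := by
    intro y hy x hx
    refine Λ.lift_induction (Λ.gens c) (fun y => (2 : ℤ) ∣ Λ.inner y x) ?_ ?_ ?_ y hy
    · intro w; rw [inner_smul_left]; exact dvd_mul_right _ _
    · intro u v h1 h2; rw [inner_add_left]; exact dvd_add h1 h2
    · intro w hw; exact s1 w hw x hx
  intro x hx
  refine (Λ.lift_induction (Λ.gens c) (fun x => Λ.red x ∈ Λ.sub c ∧ (4 : ℤ) ∣ Λ.inner x x) ?_ ?_ ?_ x hx).2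
  · intro w
    refine ⟨by rw [red_two]; exact zero_mem _, ?_⟩
    rw [inner_smul_right, inner_smul_left]
    omega
  · rintro u v ⟨hu1, hu2⟩ ⟨hv1, hv2⟩
    refine ⟨by rw [red_add]; exact add_mem hu1 hv1, ?_⟩
    have := s2 u hu1 v hv1
    have e := Λ.inner_symm u v
    simp only [inner_add_left, inner_add_right]
    omega
  · intro z hz
    exact ⟨Submodule.subset_span ⟨z, hz, rfl⟩, Λ.gens_norm hΛ hz⟩

lemma half_sum {c : Fin 24 → ZMod 2} {f g : Fin 24 → ℤ} (hf : f ∈ Λ.frame c) (hg : g ∈ Λ.frame c) :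
    ∃ z ∈ Λ.gens c, (2 : ℤ) • z = f + g := by
  obtain ⟨w, hw⟩ := Λ.red_eq ((Λ.mem_frame.1 hf).2.trans (Λ.mem_frame.1 hg).2.symm)
  have : (2 : ℤ) • (g + w) = f + g := by rw [hw]; module
  exact ⟨g + w, ⟨f, hf, g, hg, this⟩, this⟩

lemma odd_inner (hΛ : IsLeech Λ) {c : Fin 24 → ZMod 2} {f : Fin 24 → ℤ} (hf : f ∈ Λ.frame c) :
    ∃ l, ¬ (2 : ℤ) ∣ Λ.inner l f := by
  by_contra hcon
  push Not at hcon
  have h1 : ∀ i, (2 : ℤ) ∣ Λ.gram.mulVec f i := by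
    intro i
    have := hcon (Pi.single i 1)
    simpa [inner] using this
  choose u hu using h1
  obtain ⟨g, hg⟩ := Λ.gramEquiv.surjective u
  have h2 : Λ.gramEquiv f = Λ.gramEquiv ((2 : ℤ) • g) := by
    change Λ.gram.mulVec f = Λ.gram.mulVec ((2 : ℤ) • g)
    rw [Matrix.mulVec_smul]
    funext i
    rw [hu i, ← hg]; rfl
  have h3 := Λ.gramEquiv.injective h2
  have h4 := (Λ.mem_frame.1 hf).1
  rw [h3, inner_smul_left, inner_smul_right] at h4
  exact hΛ g (by omega)

/-- the core spanning statement -/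
lemma mem_sub_of_four {c : Fin 24 → ZMod 2} {T : Finset (Fin 24 → ℤ)} (hT : T ⊆ Λ.frame c)
    (ho : ∀ u ∈ T, ∀ v ∈ T, u ≠ v → Λ.inner u v = 0) (hcard : T.card = 24)
    (y : Fin 24 → ℤ) (hy : (4 : ℤ) ∣ Λ.inner y y) (h4 : ∀ f ∈ T, (4 : ℤ) ∣ Λ.inner y f) :
    Λ.red y ∈ Λ.sub c := by
  classical
  set n : (Fin 24 → ℤ) → ℤ := fun f => Λ.inner y f / 4 with hn
  have hn4 : ∀ f ∈ T, Λ.inner y f = 4 * n f := fun f hf => by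
    have := h4 f hf
    simp only [hn]; omega
  have h8 : ∀ f ∈ T, Λ.inner f f = 8 := fun f hf => (Λ.mem_frame.1 (hT hf)).1
  have hsumT : ∀ f ∈ T, Λ.inner (∑ g ∈ T, n g • g) f = 8 * n f := by
    intro f hf
    rw [inner_sum_left, Finset.sum_eq_single f]
    · rw [inner_smul_left, h8 f hf]; ring
    · intro g hg hgf
      rw [inner_smul_left, ho g hg f hf hgf, mul_zero]
    · intro h; exact absurd hf h
  set δ := (2 : ℤ) • y - ∑ g ∈ T, n g • g with hδ
  have hδo : ∀ f ∈ T, Λ.inner δ f = 0 := by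
    intro f hf
    rw [hδ, inner_sub_left, hsumT f hf, inner_smul_left, hn4 f hf]; ring
  have hδ0 : δ = 0 := by
    by_contra hne
    have hmem : δ ∉ T := by
      intro h
      have h1 := hδo δ h
      have h2 := h8 δ h
      omega
    have := Λ.card_orth_le (insert δ T) (by
      intro x hx
      rcases Finset.mem_insert.1 hx with rfl | hx
      · exact hne
      · intro h
        have := h8 x hx
        rw [h, inner_zero_left] at this; omega) (by
      intro u hu v hv huv
      rcases Finset.mem_insert.1 hu with rfl | hu <;> rcases Finset.mem_insert.1 hv with rfl | hv
      · exact absurd rfl huv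
      · exact hδo v hv
      · rw [inner_symm]; exact hδo u hu
      · exact ho u hu v hv huv)
    rw [Finset.card_insert_of_notMem hmem, hcard] at this
    omega
  have h2y : (2 : ℤ) • y = ∑ g ∈ T, n g • g := sub_eq_zero.1 hδ0
  have hyy : Λ.inner y y = 2 * ∑ f ∈ T, n f * n f := by
    have e1 : Λ.inner ((2 : ℤ) • y) y = ∑ f ∈ T, n f * (4 * n f) := by
      rw [h2y, inner_sum_left]
      refine Finset.sum_congr rfl fun f hf => ?_
      rw [inner_smul_left, inner_symm, hn4 f hf]
    rw [inner_smul_left] at e1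
    have e2 : ∑ f ∈ T, n f * (4 * n f) = 4 * ∑ f ∈ T, n f * n f := by
      rw [Finset.mul_sum]; exact Finset.sum_congr rfl fun f _ => by ring
    omega
  have hpar : (2 : ℤ) ∣ ∑ f ∈ T, n f := by
    have h1 : (2 : ℤ) ∣ ∑ f ∈ T, n f * n f := by omega
    have h2 : (2 : ℤ) ∣ ∑ f ∈ T, (n f * n f - n f) := by
      refine Finset.dvd_sum fun f _ => ?_
      have := Int.even_mul_pred_self (n f)
      rw [mul_sub, mul_one] at this
      exact this.two_dvd
    rw [Finset.sum_sub_distrib] at h2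
    omega
  obtain ⟨k, hk⟩ := hpar
  obtain ⟨f1, hf1⟩ : T.Nonempty := by rw [← Finset.card_pos, hcard]; norm_num
  have hz : ∀ f : Fin 24 → ℤ, ∃ z, f ∈ T → z ∈ Λ.gens c ∧ (2 : ℤ) • z = f + f1 := by
    intro f
    by_cases hf : f ∈ T
    · obtain ⟨z, h1, h2⟩ := Λ.half_sum (hT hf) (hT hf1)
      exact ⟨z, fun _ => ⟨h1, h2⟩⟩
    · exact ⟨0, fun h => absurd h hf⟩
  choose z hz using hz
  have hyeq : y = ∑ f ∈ T, n f • z f - k • f1 := by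
    apply two_smul_inj
    rw [h2y, smul_sub, Finset.smul_sum]
    have : ∑ f ∈ T, (2 : ℤ) • n f • z f = ∑ f ∈ T, n f • f + (∑ f ∈ T, n f) • f1 := by
      rw [Finset.sum_smul, ← Finset.sum_add_distrib]
      refine Finset.sum_congr rfl fun f hf => ?_
      rw [smul_comm, (hz f hf).2, smul_add]
    rw [this, hk, mul_smul]
    abel
  have hf1g : f1 ∈ Λ.gens c := ⟨f1, hT hf1, f1, hT hf1, by rw [two_smul]⟩
  have hin : ∀ x ∈ Λ.gens c, ∀ j : ℤ, Λ.red (j • x) ∈ Λ.sub c := by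
    intro x hx j
    rw [red_smul]
    exact Submodule.smul_mem _ _ (Submodule.subset_span ⟨x, hx, rfl⟩)
  rw [hyeq, sub_eq_add_neg, red_add, red_neg, red_sum]
  exact add_mem (sum_mem fun f hf => hin _ (hz f hf).1 _) (neg_mem (hin _ hf1g _))

lemma sub_maximal (hΛ : IsLeech Λ) {c : Fin 24 → ZMod 2} (hc : c ∈ Λ.img 4) :
    Λ.MaximalIsotropic (Λ.sub c) := by
  refine ⟨Λ.sub_isotropic hΛ c, fun F' hF' hle => le_antisymm ?_ hle⟩
  obtain ⟨T, hT, hT2, ho⟩ := Λ.exists_half_frame hΛ c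
  have hcard : T.card = 24 := by
    have := (Λ.card_frames hΛ).2 c hc
    have := Λ.half_frame_card hT ho
    omega
  intro a ha
  obtain ⟨y, rfl⟩ := Λ.red_surj a
  have hyy := hF' y ha
  have heven : ∀ z ∈ Λ.gens c, (2 : ℤ) ∣ Λ.inner y z := by
    intro z hz
    have hz' : Λ.red z ∈ F' := hle (Submodule.subset_span ⟨z, hz, rfl⟩)
    have h1 := hF' z hz'
    have h2 := hF' (y + z) (by rw [red_add]; exact add_mem ha hz')
    have e := Λ.inner_symm y z
    simp only [inner_add_left, inner_add_right] at h2
    omega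
  have hsum : ∀ f ∈ T, ∀ g ∈ T, (4 : ℤ) ∣ Λ.inner y f + Λ.inner y g := by
    intro f hf g hg
    obtain ⟨z, hz, hzz⟩ := Λ.half_sum (hT hf) (hT hg)
    have h1 := heven z hz
    rw [← inner_add_right, ← hzz, inner_smul_right]
    omega
  obtain ⟨f1, hf1⟩ : T.Nonempty := by rw [← Finset.card_pos, hcard]; norm_num
  by_cases h4 : (4 : ℤ) ∣ Λ.inner y f1
  · refine Λ.mem_sub_of_four hT ho hcard y hyy fun f hf => ?_
    have := hsum f hf f1 hf1
    omega
  · obtain ⟨l, hl⟩ := Λ.odd_inner hΛ (hT hf1)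
    have hred : Λ.red (y - (2 : ℤ) • l) = Λ.red y := by
      rw [sub_eq_add_neg, red_add, red_neg, red_two, neg_zero, add_zero]
    rw [← hred]
    refine Λ.mem_sub_of_four hT ho hcard _ ?_ fun f hf => ?_
    · have e := Λ.inner_symm y l
      simp only [inner_sub_left, inner_sub_right, inner_smul_left, inner_smul_right]
      omega
    · have h1 := hsum f hf f1 hf1
      have h2 := hsum f1 hf1 f1 hf1
      obtain ⟨w, hw⟩ := Λ.red_eq ((Λ.mem_frame.1 (hT hf)).2.trans (Λ.mem_frame.1 (hT hf1)).2.symm)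
      have h3 : Λ.inner l f = Λ.inner l f1 + 2 * Λ.inner l w := by
        rw [hw, inner_add_right, inner_smul_right]
      rw [inner_sub_left, inner_smul_left]
      omega

end EvenUnimodularLattice

open Matrix Module

namespace EvenUnimodularLattice
variable (Λ : EvenUnimodularLattice 24)

/-- The automorphism group of the lattice. -/
def autG : Subgroup (Matrix (Fin 24) (Fin 24) ℤ)ˣ where
  carrier := {U | (U.1)ᵀ * Λ.gram * U.1 = Λ.gram}
  one_mem' := by simp
  mul_mem' := by
    intro U V hU hV
    simp only [Set.mem_setOf_eq] at *
    calc ((U * V).1)ᵀ * Λ.gram * (U * V).1 = (V.1)ᵀ * ((U.1)ᵀ * Λ.gram * U.1) * V.1 := by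
          simp only [Units.val_mul, Matrix.transpose_mul, Matrix.mul_assoc]
      _ = Λ.gram := by rw [hU, hV]
  inv_mem' := by
    intro U hU
    simp only [Set.mem_setOf_eq] at *
    have h1 : U.1 * (U⁻¹).1 = 1 := by simp
    have h2 : ((U⁻¹).1)ᵀ * (U.1)ᵀ = 1 := by rw [← Matrix.transpose_mul, h1, Matrix.transpose_one]
    calc ((U⁻¹).1)ᵀ * Λ.gram * (U⁻¹).1 = ((U⁻¹).1)ᵀ * ((U.1)ᵀ * Λ.gram * U.1) * (U⁻¹).1 := by rw [hU]
      _ = (((U⁻¹).1)ᵀ * (U.1)ᵀ) * Λ.gram * (U.1 * (U⁻¹).1) := by simp only [Matrix.mul_assoc]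
      _ = Λ.gram := by rw [h1, h2]; simp

lemma aut_unit {U : Matrix (Fin 24) (Fin 24) ℤ} (h : Uᵀ * Λ.gram * U = Λ.gram) : IsUnit U := by
  rw [Matrix.isUnit_iff_isUnit_det]
  have := congrArg Matrix.det h
  rw [Matrix.det_mul, Matrix.det_mul, Λ.unimodular, mul_one] at this
  exact IsUnit.of_mul_eq_one_right _ this

/-- the mod 2 reduction of a matrix as a linear map -/
def redM (U : Matrix (Fin 24) (Fin 24) ℤ) : (Fin 24 → ZMod 2) →ₗ[ZMod 2] (Fin 24 → ZMod 2) :=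
  Matrix.mulVecLin (U.map (Int.cast : ℤ → ZMod 2))

lemma redM_red (U : Matrix (Fin 24) (Fin 24) ℤ) (x : Fin 24 → ℤ) :
    redM U (Λ.red x) = Λ.red (U.mulVec x) := by
  funext i
  simp [redM, red, Matrix.mulVec, dotProduct]

lemma redM_one : redM 1 = LinearMap.id := by
  have : (1 : Matrix (Fin 24) (Fin 24) ℤ).map (Int.cast : ℤ → ZMod 2) = 1 := by
    apply Matrix.map_one <;> simp
  rw [redM, this, Matrix.mulVecLin_one]

lemma redM_mul (U V : Matrix (Fin 24) (Fin 24) ℤ) : redM (U * V) = (redM U).comp (redM V) := by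
  have : (U * V).map (Int.cast : ℤ → ZMod 2) = U.map (Int.cast : ℤ → ZMod 2) * V.map (Int.cast : ℤ → ZMod 2) :=
    Matrix.map_mul (f := Int.castRingHom (ZMod 2))
  rw [redM, this, Matrix.mulVecLin_mul]; rfl

lemma aut_inner {U : Matrix (Fin 24) (Fin 24) ℤ} (h : Uᵀ * Λ.gram * U = Λ.gram) (x y : Fin 24 → ℤ) :
    Λ.inner (U.mulVec x) (U.mulVec y) = Λ.inner x y := by
  unfold inner
  conv_rhs => rw [← h, ← Matrix.mulVec_mulVec, ← Matrix.mulVec_mulVec, Matrix.dotProduct_mulVec,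
    Matrix.vecMul_transpose]

lemma aut_frame {U : Matrix (Fin 24) (Fin 24) ℤ} (h : Uᵀ * Λ.gram * U = Λ.gram) {c : Fin 24 → ZMod 2}
    {v : Fin 24 → ℤ} (hv : v ∈ Λ.frame c) : U.mulVec v ∈ Λ.frame (redM U c) := by
  rw [mem_frame] at *
  rw [Λ.aut_inner h, ← redM_red, hv.2]
  exact ⟨hv.1, rfl⟩

lemma aut_sub_le {U : Matrix (Fin 24) (Fin 24) ℤ} (h : Uᵀ * Λ.gram * U = Λ.gram) (c : Fin 24 → ZMod 2) :
    (Λ.sub c).map (redM U) ≤ Λ.sub (redM U c) := by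
  rw [sub, Submodule.map_span, Submodule.span_le]
  rintro _ ⟨_, ⟨z, ⟨f, hf, g, hg, hz⟩, rfl⟩, rfl⟩
  rw [redM_red]
  refine Submodule.subset_span ⟨_, ⟨_, Λ.aut_frame h hf, _, Λ.aut_frame h hg, ?_⟩, rfl⟩
  rw [← Matrix.mulVec_smul, hz, Matrix.mulVec_add]

lemma mem_img4 {c : Fin 24 → ZMod 2} : c ∈ Λ.img 4 ↔ (Λ.frame c).Nonempty := by
  simp [img, frame, Finset.Nonempty]

/-- image of a class of norm-8 vectors -/
def smulX (U : Λ.autG) (c : Λ.img 4) : Λ.img 4 :=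
  ⟨redM U.1.1 c.1, by
    obtain ⟨v, hv⟩ := Λ.mem_img4.1 c.2
    exact Λ.mem_img4.2 ⟨_, Λ.aut_frame U.2 hv⟩⟩

lemma smulX_val (U : Λ.autG) (c : Λ.img 4) : (Λ.smulX U c).1 = redM U.1.1 c.1 := by
  unfold smulX
  with_reducible rfl

/-- action on classes of norm-8 vectors -/
@[reducible] def actX : MulAction Λ.autG (Λ.img 4) where
  smul U c := Λ.smulX U c
  one_smul c := by
    apply Subtype.ext
    change redM 1 c.1 = c.1
    rw [redM_one]; rfl
  mul_smul U V c := by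
    apply Subtype.ext
    change redM (U.1.1 * V.1.1) c.1 = redM U.1.1 (redM V.1.1 c.1)
    rw [redM_mul]; rfl

lemma actX_fix (U : Λ.autG) (c : Λ.img 4) (h : Λ.actX.toSMul.smul U c = c) : redM U.1.1 c.1 = c.1 := by
  change Λ.smulX U c = c at h
  rw [← smulX_val, h]

/-- action on subspaces -/
@[reducible] def actS : MulAction Λ.autG (Submodule (ZMod 2) (Fin 24 → ZMod 2)) where
  smul U F := F.map (redM U.1.1)
  one_smul F := by
    change F.map (redM 1) = F
    rw [redM_one, Submodule.map_id]
  mul_smul U V F := by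
    change F.map (redM (U.1.1 * V.1.1)) = (F.map (redM V.1.1)).map (redM U.1.1)
    rw [redM_mul, Submodule.map_comp]

lemma aut_sub_eq (U : Λ.autG) (c : Fin 24 → ZMod 2) :
    (Λ.sub c).map (redM U.1.1) = Λ.sub (redM U.1.1 c) := by
  refine le_antisymm (Λ.aut_sub_le U.2 c) ?_
  have h1 := Λ.aut_sub_le (U⁻¹).2 (redM U.1.1 c)
  have e1 : redM (U⁻¹ : Λ.autG).1.1 (redM U.1.1 c) = c := by
    rw [← LinearMap.comp_apply, ← redM_mul]
    simp [redM_one]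
  rw [e1] at h1
  have h2 := Submodule.map_mono (f := redM U.1.1) h1
  rw [← Submodule.map_comp, ← redM_mul] at h2
  simpa [redM_one] using h2

lemma exists_odd_orbit {G X : Type*} [Group G] [Finite X] [MulAction G X] (h : Odd (Nat.card X)) :
    ∃ x : X, Odd (Nat.card (MulAction.orbit G x)) := by
  classical
  by_contra hcon
  push Not at hcon
  have := Fintype.ofFinite (MulAction.orbitRel.Quotient G X)
  have e := Nat.card_congr (MulAction.selfEquivSigmaOrbits G X)
  rw [Nat.card_sigma] at e
  rw [e] at h
  refine (Nat.not_even_iff_odd.2 h) ?_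
  rw [even_iff_two_dvd]
  refine Finset.dvd_sum fun ω _ => ?_
  exact (Nat.not_odd_iff_even.1 (hcon ω.out)).two_dvd

theorem main (hΛ : IsLeech Λ) :
    ∃ F₀ : Submodule (ZMod 2) (Fin 24 → ZMod 2), Λ.MaximalIsotropic F₀ ∧
      Odd (Nat.card {F : Submodule (ZMod 2) (Fin 24 → ZMod 2) //
        ∃ U : Matrix (Fin 24) (Fin 24) ℤ, Uᵀ * Λ.gram * U = Λ.gram ∧
          Submodule.map (Matrix.mulVecLin (U.map (Int.cast : ℤ → ZMod 2))) F₀ = F}) := by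
  letI := Λ.actX
  letI := Λ.actS
  have hodd : Odd (Nat.card (Λ.img 4)) := by
    rw [Nat.card_eq_fintype_card, Fintype.card_coe, (Λ.card_frames hΛ).1]
    exact ⟨4146187, by norm_num⟩
  obtain ⟨c, hc⟩ := exists_odd_orbit (G := Λ.autG) hodd
  refine ⟨Λ.sub c.1, Λ.sub_maximal hΛ c.2, ?_⟩
  have hstab : MulAction.stabilizer Λ.autG c ≤ MulAction.stabilizer Λ.autG (Λ.sub c.1) := by
    intro U hU
    rw [MulAction.mem_stabilizer_iff] at *
    have h1 : redM U.1.1 c.1 = c.1 := Λ.actX_fix U c hU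
    change (Λ.sub c.1).map (redM U.1.1) = Λ.sub c.1
    rw [aut_sub_eq, h1]
  have hdvd := Subgroup.index_dvd_of_le hstab
  rw [MulAction.index_stabilizer, MulAction.index_stabilizer] at hdvd
  have hset : {F : Submodule (ZMod 2) (Fin 24 → ZMod 2) |
        ∃ U : Matrix (Fin 24) (Fin 24) ℤ, Uᵀ * Λ.gram * U = Λ.gram ∧
          Submodule.map (Matrix.mulVecLin (U.map (Int.cast : ℤ → ZMod 2))) (Λ.sub c.1) = F} =
      MulAction.orbit Λ.autG (Λ.sub c.1) := by
    ext F
    constructor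
    · rintro ⟨U, hU, rfl⟩
      obtain ⟨V, rfl⟩ := Λ.aut_unit hU
      exact ⟨⟨V, hU⟩, rfl⟩
    · rintro ⟨U, rfl⟩
      exact ⟨U.1.1, U.2, rfl⟩
  change Odd (Nat.card {F : Submodule (ZMod 2) (Fin 24 → ZMod 2) |
        ∃ U : Matrix (Fin 24) (Fin 24) ℤ, Uᵀ * Λ.gram * U = Λ.gram ∧
          Submodule.map (Matrix.mulVecLin (U.map (Int.cast : ℤ → ZMod 2))) (Λ.sub c.1) = F})
  rw [hset, Nat.card_coe_set_eq]
  rw [Nat.card_coe_set_eq] at hc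
  exact Odd.of_dvd_nat hc hdvd

end EvenUnimodularLattice

/-- For the Leech lattice `Λ` there is a maximal isotropic
subspace `F₀` of `Λ/2Λ` whose orbit under `Aut(Λ)` has odd cardinality. -/
theorem exists_max_isotropic_with_odd_orbit (Λ : EvenUnimodularLattice 24)
    (hΛ : IsLeech Λ) :
    ∃ F₀ : Submodule (ZMod 2) (Fin 24 → ZMod 2), Λ.MaximalIsotropic F₀ ∧
      Odd (Nat.card {F : Submodule (ZMod 2) (Fin 24 → ZMod 2) //
        ∃ U : Matrix (Fin 24) (Fin 24) ℤ, Uᵀ * Λ.gram * U = Λ.gram ∧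
          Submodule.map (Matrix.mulVecLin (U.map (Int.cast : ℤ → ZMod 2))) F₀ = F}) := by
  exact Λ.main hΛ
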